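/- Let M be a Σ₁ alternating Turing machine and w ∈ Σ*, with c₀ the initial configuration for w. Then M accepts w if and only if there exists a universal configuration c' with c₀ ⇑∃ c', i.e., c' is reachable from c₀ by a finite chain of yield-steps passing only through existential configurations. -/

import Mathlib

namespace ATMPaper

/-- Actions of a Turing machine: overwrite the scanned symbol by a letter,
move the cursor backward (`left`), or forward (`right`). -/
inductive Act (Γ : Type) : Type
  | write : Γ → Act Γ
  | left : Act Γ
  | right : Act Γ

/-- A cursored tape `u γ̲ v`: the string `u` to the left of the cursor,
the scanned symbol `γ`, and the string `v` to the right. -/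
abbrev Tape (Γ : Type) : Type := List Γ × Γ × List Γ

/-- The scanned symbol of a cursored tape. -/
def Tape.scan {Γ : Type} (t : Tape Γ) : Γ := t.2.1

/-- The effect of an action on a cursored tape (with blank symbol `blank`):
moving forward past the right end extends the tape with a blank, and moving
backward at the left end leaves the cursor in place. -/
inductive ActStep {Γ : Type} (blank : Γ) : Act Γ → Tape Γ → Tape Γ → Prop
  | fwd (u : List Γ) (γ τ : Γ) (v : List Γ) :
      ActStep blank Act.right (u, γ, τ :: v) (u ++ [γ], τ, v)
  | fwdEnd (u : List Γ) (γ : Γ) :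
      ActStep blank Act.right (u, γ, []) (u ++ [γ], blank, [])
  | bwd (u : List Γ) (τ γ : Γ) (v : List Γ) :
      ActStep blank Act.left (u ++ [τ], γ, v) (u, τ, γ :: v)
  | bwdEnd (γ : Γ) (v : List Γ) :
      ActStep blank Act.left ([], γ, v) ([], γ, v)
  | write (u : List Γ) (γ τ : Γ) (v : List Γ) :
      ActStep blank (Act.write τ) (u, γ, v) (u, τ, v)

section Generic

variable {C : Type*} (isE : C → Bool) (step : C → C → Prop)

/-- A chain of steps `c = c₀ → ⋯ → cₙ = c'` (`n ≥ 0`) in which `c₀,…,cₙ₋₁`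
are all existential. -/
inductive EChain : C → C → Prop
  | refl (c : C) : EChain c c
  | step {c c' c'' : C} : isE c = true → step c c' → EChain c' c'' → EChain c c''

/-- A chain of steps `c = c₀ → ⋯ → cₙ = c'` (`n ≥ 0`) in which `c₀,…,cₙ₋₁`
are all universal. -/
inductive UChain : C → C → Prop
  | refl (c : C) : UChain c c
  | step {c c' c'' : C} : isE c = false → step c c' → UChain c' c'' → UChain c c''

/-- `c ⇑∃ c'` : `c'` is universal and reachable from `c` by a chain passing
only through existential configurations. -/
def EPivot (c c' : C) : Prop := EChain isE step c c' ∧ isE c' = false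

/-- `c ⇑∀ c'` : `c'` is existential and reachable from `c` by a chain passing
only through universal configurations. -/
def UPivot (c c' : C) : Prop := UChain isE step c c' ∧ isE c' = true

/-- The set `AC` of accepted configurations: the least set `S` such that
(i) an existential `c` with some pivot `c ⇑∃ c'`, `c' ∈ S`, is in `S`, and
(ii) a universal `c` all of whose pivots `c ⇑∀ c'` lie in `S` is in `S`. -/
inductive Accepted : C → Prop
  | ex {c c' : C} : isE c = true → EPivot isE step c c' → Accepted c' → Accepted c
  | univ {c : C} : isE c = false → (∀ c', UPivot isE step c c' → Accepted c') →
      Accepted c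

/-- The set `RC` of rejected configurations: the least set `S` such that
(i) an existential `c` all of whose pivots `c ⇑∃ c'` lie in `S` is in `S`, and
(ii) a universal `c` with some pivot `c ⇑∀ c'`, `c' ∈ S`, is in `S`. -/
inductive Rejected : C → Prop
  | ex {c : C} : isE c = true → (∀ c', EPivot isE step c c' → Rejected c') →
      Rejected c
  | univ {c c' : C} : isE c = false → UPivot isE step c c' → Rejected c' →
      Rejected c

end Generic

/-- An alternating Turing machine over input alphabet `α`, with (finite)
machine alphabet `Γ` into which `α` embeds, a blank symbol (not a letter
of `α`), a finite set `Q` of states each of which is existential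
(`isE q = true`) or universal (`isE q = false`), a start state, and a
transition relation `δ`. -/
structure ATM (α Γ : Type) where
  ΓFin : Finite Γ
  emb : α ↪ Γ
  blank : Γ
  blank_ne : ∀ a : α, emb a ≠ blank
  Q : Type
  QFin : Finite Q
  isE : Q → Bool
  start : Q
  δ : Q → Γ → Act Γ → Q → Prop

namespace ATM

variable {α Γ : Type} (M : ATM α Γ)

/-- A configuration: a state together with a cursored tape. -/
abbrev Cfg : Type := M.Q × Tape Γ

/-- A configuration is existential or universal according to its state. -/
def cfgE (c : M.Cfg) : Bool := M.isE c.1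

/-- The one-step yield relation between configurations. -/
def Yield (c c' : M.Cfg) : Prop :=
  ∃ a : Act Γ, M.δ c.1 (Tape.scan c.2) a c'.1 ∧ ActStep M.blank a c.2 c'.2

/-- `c ⇑∃ c'` for configurations of `M`. -/
def EPiv (c c' : M.Cfg) : Prop := ATMPaper.EPivot M.cfgE M.Yield c c'

/-- `c ⇑∀ c'` for configurations of `M`. -/
def UPiv (c c' : M.Cfg) : Prop := ATMPaper.UPivot M.cfgE M.Yield c c'

/-- `c` is an accepted configuration of `M`. -/
def Accepted (c : M.Cfg) : Prop := ATMPaper.Accepted M.cfgE M.Yield c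

/-- `c` is a rejected configuration of `M`. -/
def Rejected (c : M.Cfg) : Prop := ATMPaper.Rejected M.cfgE M.Yield c

/-- The initial configuration `(s₀, ε, ⊔, w)` for input `w`. -/
def init (w : List α) : M.Cfg := (M.start, ([], M.blank, w.map M.emb))

/-- `M` accepts the input string `w`. -/
def Accepts (w : List α) : Prop := M.Accepted (M.init w)

/-- `M` rejects the input string `w`. -/
def Rejects (w : List α) : Prop := M.Rejected (M.init w)

/-- The language `L(M)` accepted by `M`. -/
def Lang : Set (List α) := {w | M.Accepts w}

/-- The language `L̄(M)` rejected by `M`. -/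
def coLang : Set (List α) := {w | M.Rejects w}

/-- `M` is total: every input is either accepted or rejected. -/
def Total : Prop := ∀ w : List α, M.Accepts w ∨ M.Rejects w

/-- `M` is one-sided: it has no accepted configurations, or no rejected ones. -/
def OneSided : Prop :=
  (∀ c : M.Cfg, ¬ M.Accepted c) ∨ (∀ c : M.Cfg, ¬ M.Rejected c)

/-- The dual machine: same data, with existential and universal states
interchanged. -/
def dual : ATM α Γ :=
  ⟨M.ΓFin, M.emb, M.blank, M.blank_ne, M.Q, M.QFin,
    fun q => !M.isE q, M.start, M.δ⟩

/-- `M` is alternation well-founded: for no input `w` is there an infinite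
sequence of yield-steps from the initial configuration for `w` in which the
type (existential/universal) changes infinitely often. -/
def AltWF : Prop :=
  ∀ w : List α, ¬∃ d : ℕ → M.Cfg, d 0 = M.init w ∧
    (∀ i : ℕ, M.Yield (d i) (d (i + 1))) ∧
    (∀ n : ℕ, ∃ m : ℕ, n ≤ m ∧ M.cfgE (d m) ≠ M.cfgE (d (m + 1)))

/-- Every chain of yield-steps from an initial configuration of `M` has at
most `k` alternation-pivots, i.e. at most `k` indices at which the type of
the configuration changes. -/
def AltBound (k : ℕ) : Prop :=
  ∀ (w : List α) (n : ℕ) (d : ℕ → M.Cfg), d 0 = M.init w →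
    (∀ i < n, M.Yield (d i) (d (i + 1))) →
    ((Finset.range n).filter fun i => M.cfgE (d i) ≠ M.cfgE (d (i + 1))).card ≤ k

/-- `M` is a `Σ_k` machine: its start state is existential and every chain of
yield-steps from an initial configuration has at most `k` alternation-pivots. -/
def IsSigmaM (k : ℕ) : Prop := M.isE M.start = true ∧ M.AltBound k

/-- `M` is a `Π_k` machine: its start state is universal and every chain of
yield-steps from an initial configuration has at most `k` alternation-pivots;
moreover for `k = 1` no transition rule applies to any existential state. -/
def IsPiM (k : ℕ) : Prop :=
  M.isE M.start = false ∧ M.AltBound k ∧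
    (k = 1 → ∀ (q : M.Q) (γ : Γ) (a : Act Γ) (q' : M.Q),
      M.δ q γ a q' → M.isE q = false)

end ATM

/-- `AltQuant α k b P` is the statement `Q₁ x₁ Q₂ x₂ ⋯ Q_k x_k, P (x₁,…,x_k)`
where the quantifiers `Qᵢ` over `List α` alternate, starting with `∃` if
`b = true` and with `∀` if `b = false`. -/
def AltQuant (α : Type) : (k : ℕ) → Bool → ((Fin k → List α) → Prop) → Prop
  | 0, _, P => P fun i => i.elim0
  | k + 1, true, P => ∃ x : List α, AltQuant α k false fun v => P (Fin.cons x v)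
  | k + 1, false, P => ∀ x : List α, AltQuant α k true fun v => P (Fin.cons x v)

/-- `L ⊆ Σ*` is `Σ⁰_k`: definable by `k` alternating quantifiers over strings,
beginning with `∃`, applied to a computable relation. -/
def IsSigma0 (α : Type) [Primcodable α] (k : ℕ) (L : Set (List α)) : Prop :=
  ∃ R : List α × (Fin k → List α) → Prop, ComputablePred R ∧
    L = {w | AltQuant α k true fun v => R (w, v)}

/-- `L ⊆ Σ*` is `Π⁰_k`: definable by `k` alternating quantifiers over strings,
beginning with `∀`, applied to a computable relation. -/
def IsPi0 (α : Type) [Primcodable α] (k : ℕ) (L : Set (List α)) : Prop :=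
  ∃ R : List α × (Fin k → List α) → Prop, ComputablePred R ∧
    L = {w | AltQuant α k false fun v => R (w, v)}

/-- `L ⊆ Σ*` is inductive (`Π¹₁`): there is a computable relation
`R ⊆ Σ* × List (Σ*)` with
`L = {w | ∀ f : ℕ → Σ*, ∃ n, R (w, [f 0, …, f n])}`. -/
def IsInductive (α : Type) [Primcodable α] (L : Set (List α)) : Prop :=
  ∃ R : List α × List (List α) → Prop, ComputablePred R ∧
    L = {w | ∀ f : ℕ → List α, ∃ n : ℕ, R (w, (List.range (n + 1)).map f)}

/-- A two-tape alternating Turing machine: as `ATM`, but configurations carry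
two cursored tapes, and transitions read both scanned symbols and perform an
action on each tape. -/
structure ATM2 (α Γ : Type) where
  ΓFin : Finite Γ
  emb : α ↪ Γ
  blank : Γ
  blank_ne : ∀ a : α, emb a ≠ blank
  Q : Type
  QFin : Finite Q
  isE : Q → Bool
  start : Q
  δ : Q → Γ → Γ → Act Γ → Act Γ → Q → Prop

namespace ATM2

variable {α Γ : Type} (M : ATM2 α Γ)

/-- A configuration of a two-tape machine: a state and two cursored tapes. -/
abbrev Cfg : Type := M.Q × Tape Γ × Tape Γ

/-- A configuration is existential or universal according to its state. -/
def cfgE (c : M.Cfg) : Bool := M.isE c.1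

/-- The one-step yield relation of a two-tape machine. -/
def Yield (c c' : M.Cfg) : Prop :=
  ∃ a₀ a₁ : Act Γ, M.δ c.1 (Tape.scan c.2.1) (Tape.scan c.2.2) a₀ a₁ c'.1 ∧
    ActStep M.blank a₀ c.2.1 c'.2.1 ∧ ActStep M.blank a₁ c.2.2 c'.2.2

/-- `c ⇑∃ c'` for configurations of `M`. -/
def EPiv (c c' : M.Cfg) : Prop := ATMPaper.EPivot M.cfgE M.Yield c c'

/-- `c ⇑∀ c'` for configurations of `M`. -/
def UPiv (c c' : M.Cfg) : Prop := ATMPaper.UPivot M.cfgE M.Yield c c'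

/-- `c` is an accepted configuration of `M`. -/
def Accepted (c : M.Cfg) : Prop := ATMPaper.Accepted M.cfgE M.Yield c

/-- `c` is a rejected configuration of `M`. -/
def Rejected (c : M.Cfg) : Prop := ATMPaper.Rejected M.cfgE M.Yield c

/-- `M` accepts `w`: the configuration reached after the (deterministic)
pre-processing phase — the start state with the input copied onto both
tapes — is accepted. -/
def Accepts (w : List α) : Prop :=
  M.Accepted (M.start, ([], M.blank, w.map M.emb), ([], M.blank, w.map M.emb))

/-- `M` rejects `w`. -/
def Rejects (w : List α) : Prop :=
  M.Rejected (M.start, ([], M.blank, w.map M.emb), ([], M.blank, w.map M.emb))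

end ATM2

/-- The combined two-tape machine `M` of two single-tape machines `M₀`, `M₁`
over a common alphabet. Its states are triples `⟨q₀,q₁,j⟩` (`j : Bool`, with
`false` for `0` and `true` for `1`), typed according to `q_j`. In control
`j = 0`, a rule `(q₀,γ₀,a,p₀)` of `M₀` acts by `a` on tape `0`, leaves tape `1`
unchanged (re-writing its scanned symbol), and passes to control `0` if `q₀`
and `p₀` are both universal, and to control `1` otherwise; symmetrically, in
control `j = 1`, a rule `(q₁,γ₁,a,p₁)` of `M₁` acts by `a` on tape `1`, leaves
tape `0` unchanged, and passes to control `1` if `q₁` and `p₁` are both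
existential, and to control `0` otherwise. -/
def combine {α Γ : Type} (M₀ M₁ : ATM α Γ) : ATM2 α Γ where
  ΓFin := M₀.ΓFin
  emb := M₀.emb
  blank := M₀.blank
  blank_ne := M₀.blank_ne
  Q := M₀.Q × M₁.Q × Bool
  QFin := by haveI := M₀.QFin; haveI := M₁.QFin; infer_instance
  isE := fun s => cond s.2.2 (M₁.isE s.2.1) (M₀.isE s.1)
  start := (M₀.start, M₁.start, false)
  δ := fun s γ₀ γ₁ a₀ a₁ p =>
    (s.2.2 = false ∧ ∃ p₀ : M₀.Q, M₀.δ s.1 γ₀ a₀ p₀ ∧ a₁ = Act.write γ₁ ∧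
        p = (p₀, s.2.1, !(!(M₀.isE s.1) && !(M₀.isE p₀)))) ∨
    (s.2.2 = true ∧ ∃ p₁ : M₁.Q, M₁.δ s.2.1 γ₁ a₁ p₁ ∧ a₀ = Act.write γ₀ ∧
        p = (s.1, p₁, M₁.isE s.2.1 && M₁.isE p₁))

end ATMPaper

namespace ATMPaper

section Generic

variable {C : Type*} {isE : C → Bool} {step : C → C → Prop} {c₀ c c' : C} {k : ℕ}

/-- Some chain of steps from `c₀` to `c` has at least `k` alternation-pivots. -/
def ReachesWithPivots (isE : C → Bool) (step : C → C → Prop) (c₀ : C) (k : ℕ) (c : C) : Prop :=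
  ∃ (n : ℕ) (d : ℕ → C), d 0 = c₀ ∧ (∀ i < n, step (d i) (d (i + 1))) ∧ d n = c ∧
    k ≤ ((Finset.range n).filter fun i => isE (d i) ≠ isE (d (i + 1))).card

theorem ReachesWithPivots.refl (c : C) : ReachesWithPivots isE step c 0 c :=
  ⟨0, fun _ => c, rfl, by simp, rfl, Nat.zero_le _⟩

theorem ReachesWithPivots.tail (h : ReachesWithPivots isE step c₀ k c) (hs : step c c') :
    ReachesWithPivots isE step c₀ (k + if isE c ≠ isE c' then 1 else 0) c' := by
  obtain ⟨n, d, h0, hd, rfl, hk⟩ := h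
  have hle : ∀ i ≤ n, (if i ≤ n then d i else c') = d i := fun i hi => if_pos hi
  have hlast : (if n + 1 ≤ n then d (n + 1) else c') = c' := if_neg (by omega)
  refine ⟨n + 1, fun i => if i ≤ n then d i else c', by simpa using h0, fun i hi => ?_, hlast, ?_⟩
  · rcases Nat.lt_succ_iff_lt_or_eq.mp hi with hi | rfl
    · simpa only [hle i hi.le, hle (i + 1) hi] using hd i hi
    · simpa only [hle i le_rfl, hlast] using hs
  · rw [Finset.card_filter, Finset.sum_range_succ]
    beta_reduce
    rw [hle n le_rfl, hlast]
    refine Nat.add_le_add_right ?_ _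
    rw [Finset.card_filter] at hk
    refine hk.trans_eq (Finset.sum_congr rfl fun i hi => ?_)
    have hi := Finset.mem_range.mp hi
    rw [hle i hi.le, hle (i + 1) hi]

theorem EChain.reachesWithPivots (hc : EChain isE step c c') (hE : isE c = true)
    (hU : isE c' = false) (h : ReachesWithPivots isE step c₀ k c) :
    ReachesWithPivots isE step c₀ (k + 1) c' := by
  induction hc with
  | refl => simp [hE] at hU
  | @step a b e _ hs htail ih =>
    have hb := h.tail hs
    cases hbE : isE b with
    | true => exact ih hbE hU (by simpa [hE, hbE] using hb)
    | false =>
      cases htail with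
      | refl => simpa [hE, hbE] using hb
      | step hb' => simp [hbE] at hb'

theorem UChain.reachesWithPivots (hc : UChain isE step c c') (hU : isE c = false)
    (hE : isE c' = true) (h : ReachesWithPivots isE step c₀ k c) :
    ReachesWithPivots isE step c₀ (k + 1) c' := by
  induction hc with
  | refl => simp [hU] at hE
  | @step a b e _ hs htail ih =>
    have hb := h.tail hs
    cases hbE : isE b with
    | false => exact ih hbE hE (by simpa [hU, hbE] using hb)
    | true =>
      cases htail with
      | refl => simpa [hU, hbE] using hb
      | step hb' => simp [hbE] at hb'

end Generic

theorem ATM.AltBound.le_of_reachesWithPivots {α Γ : Type} {M : ATM α Γ} {k m : ℕ}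
    (hM : M.AltBound k) {w : List α} {c : M.Cfg}
    (h : ReachesWithPivots M.cfgE M.Yield (M.init w) m c) : m ≤ k := by
  obtain ⟨n, d, h0, hd, -, hm⟩ := h
  exact hm.trans (hM w n d h0 hd)

end ATMPaper

open ATMPaper in
/-- a `Σ₁` alternating Turing machine `M` accepts `w` iff there
is a universal configuration `c'` with `c₀ ⇑∃ c'`, where `c₀` is the initial
configuration for `w`. -/
theorem stmt10 {α Γ : Type} (M : ATM α Γ) (hM : M.IsSigmaM 1) (w : List α) :
    M.Accepts w ↔ ∃ c' : M.Cfg, M.EPiv (M.init w) c' := by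
  constructor
  · intro h
    cases h with
    | ex _ hp _ => exact ⟨_, hp⟩
    | univ hU _ => exact absurd (hM.1.symm.trans hU) Bool.noConfusion
  · rintro ⟨c', hc, hU⟩
    refine Accepted.ex hM.1 ⟨hc, hU⟩ (Accepted.univ hU fun e he => ?_)
    have h := he.1.reachesWithPivots hU he.2
      (hc.reachesWithPivots hM.1 hU (ReachesWithPivots.refl _))
    have := hM.2.le_of_reachesWithPivots h
    omega
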